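/- Let C ∈ ℝ with C ≠ 0 and let I ⊆ ℝ be a nonempty open interval. There is no C³ function u : I → ℝ satisfying simultaneously C·u'''(x) = u''(x) for all x ∈ I, C·(u'(x)u''(x))' = u'''(x) for all x ∈ I, and u'''(x₀) ≠ 0 for some x₀ ∈ I. -/

import Mathlib

/-- Impossibility in the subcase `r ≡ C` of the classification of flat translation
surfaces: for `C ≠ 0` there is no `C³` function `u` on a nonempty open interval `I`
satisfying `C·u''' = u''` and `C·(u'u'')' = u'''` on `I` while `u'''` is nonzero
somewhere on `I`. -/
theorem no_solution_constant_r_case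
    (C : ℝ) (hC : C ≠ 0)
    (I : Set ℝ) (hI : IsOpen I) (hI' : I.OrdConnected) (hIne : I.Nonempty) :
    ¬ ∃ u : ℝ → ℝ, ContDiffOn ℝ 3 u I ∧
      (∀ x ∈ I, C * deriv (deriv (deriv u)) x = deriv (deriv u) x) ∧
      (∀ x ∈ I, C * deriv (fun t => deriv u t * deriv (deriv u) t) x =
        deriv (deriv (deriv u)) x) ∧
      (∃ x₀ ∈ I, deriv (deriv (deriv u)) x₀ ≠ 0) := by
  rintro ⟨u, hu, hlin, hprod, x₀, hx₀, hne⟩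
  have hu₁ : ContDiffOn ℝ 2 (deriv u) I := hu.deriv_of_isOpen hI (by norm_num)
  have hu₂ : ContDiffOn ℝ 1 (deriv (deriv u)) I := hu₁.deriv_of_isOpen hI (by norm_num)
  have hd₁ : ∀ x ∈ I, HasDerivAt (deriv u) (deriv (deriv u) x) x := fun x hx =>
    ((hu₁.differentiableOn (by norm_num)).differentiableAt (hI.mem_nhds hx)).hasDerivAt
  have hd₂ : ∀ x ∈ I, HasDerivAt (deriv (deriv u)) (deriv (deriv (deriv u)) x) x := fun x hx =>
    ((hu₂.differentiableOn (by norm_num)).differentiableAt (hI.mem_nhds hx)).hasDerivAt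
  -- Eliminating the third derivative leaves an algebraic relation between the first two.
  have hrel : ∀ x ∈ I, C ^ 2 * (deriv (deriv u) x * deriv (deriv u) x)
      + C * (deriv u x * deriv (deriv u) x) - deriv (deriv u) x = 0 := by
    intro x hx
    have h := hprod x hx
    rw [((hd₁ x hx).fun_mul (hd₂ x hx)).deriv] at h
    linear_combination C * h + (1 - C * deriv u x) * hlin x hx
  have hderiv := ((((hd₂ x₀ hx₀).fun_mul (hd₂ x₀ hx₀)).const_mul (C ^ 2)).fun_add
    (((hd₁ x₀ hx₀).fun_mul (hd₂ x₀ hx₀)).const_mul C)).fun_sub (hd₂ x₀ hx₀)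
  have hzero := hderiv.unique ((hasDerivAt_const x₀ (0 : ℝ)).congr_of_eventuallyEq
    (Filter.eventually_of_mem (hI.mem_nhds hx₀) hrel))
  have hrel₀ := hrel x₀ hx₀
  rw [← hlin x₀ hx₀] at hzero hrel₀
  have hsq : 2 * C ^ 4 * deriv (deriv (deriv u)) x₀ ^ 2 = 0 := by
    linear_combination C * hzero - hrel₀
  exact mul_ne_zero (mul_ne_zero two_ne_zero (pow_ne_zero 4 hC)) (pow_ne_zero 2 hne) hsq
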